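/- Let X be a locally compact Hausdorff space, H a separable complex Hilbert space, and p ∈ [1,∞). Let S, T : X → B(H) be bounded, with 0 ≤ S(x) ≤ T(x) for all x ∈ X; assume T ∈ C₀(X, S_p(H)) and that x ↦ S(x) is continuous in operator norm. Then S(x) ∈ S_p(H) for every x, the function x ↦ tr S(x)^p lies in C₀(X), and tr S(x)^p ≤ tr T(x)^p for every x ∈ X. -/

import Mathlib

open ContinuousLinearMap Filter Topology

noncomputable section

variable {H : Type*} [NormedAddCommGroup H] [InnerProductSpace ℂ H] [CompleteSpace H]
  [TopologicalSpace.SeparableSpace H]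

local notation "⟪" x ", " y "⟫" => @inner ℂ _ _ x y

/-- `|T|^p = (T*T)^{p/2}`, via the continuous functional calculus. -/
def absPow (T : H →L[ℂ] H) (p : ℝ) : H →L[ℂ] H :=
  cfc (fun t : ℝ => t ^ (p / 2)) (ContinuousLinearMap.adjoint T ∘L T)

/-- The trace `∑ᵢ ⟨fᵢ, A fᵢ⟩ ∈ [0,∞]` of a positive operator `A`, computed in the
orthonormal basis `f` (for positive `A` the value is independent of the basis). -/
def posTr (f : HilbertBasis ℕ ℂ H) (A : H →L[ℂ] H) : ENNReal :=
  ∑' i, ENNReal.ofReal (RCLike.re ⟪f i, A (f i)⟫)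

/-- `tr |T|^p ∈ [0,∞]`. `T` lies in the Schatten class `S_p(H)` iff this is finite. -/
def trAbsPow (f : HilbertBasis ℕ ℂ H) (T : H →L[ℂ] H) (p : ℝ) : ENNReal :=
  posTr f (absPow T p)

/-- The Schatten `p`-norm `‖T‖_p = (tr |T|^p)^{1/p}`. -/
def sNorm (f : HilbertBasis ℕ ℂ H) (p : ℝ) (T : H →L[ℂ] H) : ℝ :=
  (trAbsPow f T p).toReal ^ (1 / p)

/-- `T : X → B(H)` belongs to `C₀(X, S_p(H))`: pointwise Schatten class, continuous
with respect to the Schatten `p`-norm, and vanishing at infinity with respect to it. -/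
def IsC0Schatten (f : HilbertBasis ℕ ℂ H) (p : ℝ) {X : Type*} [TopologicalSpace X]
    (T : X → H →L[ℂ] H) : Prop :=
  (∀ x, trAbsPow f (T x) p ≠ ⊤) ∧
  (∀ x, Tendsto (fun y => sNorm f p (T y - T x)) (nhds x) (nhds 0)) ∧
  Tendsto (fun x => sNorm f p (T x)) (cocompact X) (nhds 0)


universe u

set_option linter.unusedSectionVars false

/-- The quadratic form of the square of a self-adjoint operator. -/
lemma re_inner_mul_self_of_isSelfAdjoint {M : H →L[ℂ] H} (hM : IsSelfAdjoint M) (v : H) :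
    RCLike.re ⟪v, (M * M) v⟫ = ‖M v‖ ^ 2 := by
  have h : ⟪v, M (M v)⟫ = ⟪M v, M v⟫ := by
    rw [← ContinuousLinearMap.adjoint_inner_left, ← ContinuousLinearMap.star_eq_adjoint, hM.star_eq]
  rw [mul_apply_eq_comp, h, inner_self_eq_norm_sq_to_K]
  norm_cast

/-- `|T|^p` is the square of a self-adjoint operator. -/
lemma exists_isSelfAdjoint_mul_self_eq_absPow (T : H →L[ℂ] H) {p : ℝ} (hp : 0 ≤ p) :
    ∃ M : H →L[ℂ] H, IsSelfAdjoint M ∧ absPow T p = M * M := by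
  refine ⟨cfc (fun t : ℝ => t ^ (p / 4)) (adjoint T ∘L T), cfc_predicate _ _, ?_⟩
  have hc : Continuous fun t : ℝ => t ^ (p / 4) := Real.continuous_rpow_const (by positivity)
  have hpos : 0 ≤ adjoint T ∘L T := star_mul_self_nonneg T
  rw [absPow, ← cfc_mul _ _ _ hc.continuousOn hc.continuousOn]
  refine cfc_congr fun t ht => ?_
  have ht0 : 0 ≤ t := spectrum_nonneg_of_nonneg hpos ht
  rw [← Real.rpow_add_of_nonneg ht0 (by positivity) (by positivity)]
  ring_nf

lemma absPow_eq_cfc_abs_rpow {A : H →L[ℂ] H} (hA : IsSelfAdjoint A) {p : ℝ} (hp : 0 ≤ p) :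
    absPow A p = cfc (fun t : ℝ => |t| ^ p) A := by
  have h : adjoint A ∘L A = cfc (fun t : ℝ => t ^ 2) A := by
    rw [cfc_pow_id A 2, sq, ← ContinuousLinearMap.star_eq_adjoint, hA.star_eq]
    rfl
  have hc : Continuous fun t : ℝ => t ^ (p / 2) := Real.continuous_rpow_const (by positivity)
  rw [absPow, h, ← cfc_comp' (fun t : ℝ => t ^ (p / 2)) (fun t => t ^ 2) A hc.continuousOn]
  refine cfc_congr fun t _ => ?_
  rw [← sq_abs, ← Real.rpow_natCast, ← Real.rpow_mul (abs_nonneg t)]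
  congr 1
  push_cast
  ring

/-- The tangent line inequality for `t ↦ |t| ^ p` at `s > 0`. -/
lemma rpow_add_mul_sub_le_abs_rpow {p s : ℝ} (hp : 1 ≤ p) (hs : 0 < s) (t : ℝ) :
    s ^ p + p * s ^ (p - 1) * (t - s) ≤ |t| ^ p := by
  have h1 : 1 + p * (|t| / s - 1) ≤ (1 + (|t| / s - 1)) ^ p :=
    one_add_mul_self_le_rpow_one_add (by linarith [div_nonneg (abs_nonneg t) hs.le]) hp
  have h2 : (1 + (|t| / s - 1)) ^ p = |t| ^ p / s ^ p := by
    rw [add_sub_cancel, Real.div_rpow (abs_nonneg t) hs.le]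
  have hsp : 0 < s ^ p := Real.rpow_pos_of_pos hs p
  have hsp1 : 0 < s ^ (p - 1) := Real.rpow_pos_of_pos hs _
  have h3 : s ^ p = s ^ (p - 1) * s := by
    rw [← Real.rpow_add_one hs.ne', sub_add_cancel]
  rw [h2, le_div_iff₀ hsp] at h1
  have h4 : (1 + p * (|t| / s - 1)) * s ^ p = s ^ p + p * s ^ (p - 1) * (|t| - s) := by
    rw [h3]
    field_simp
  have h5 : p * s ^ (p - 1) * (t - s) ≤ p * s ^ (p - 1) * (|t| - s) := by
    gcongr
    exact le_abs_self t
  linarith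

lemma re_inner_le_of_le {A B : H →L[ℂ] H} (h : A ≤ B) (v : H) :
    RCLike.re ⟪v, A v⟫ ≤ RCLike.re ⟪v, B v⟫ := by
  have := ((ContinuousLinearMap.le_def A B).1 h).re_inner_nonneg_right v
  simpa [inner_sub_right] using this

lemma re_inner_cfc_affine {A : H →L[ℂ] H} (hA : IsSelfAdjoint A) (a b : ℝ) (v : H) :
    RCLike.re ⟪v, cfc (fun t : ℝ => a + b * t) A v⟫
      = a * ‖v‖ ^ 2 + b * RCLike.re ⟪v, A v⟫ := by
  rw [cfc_add _ _ _ (by fun_prop) (by fun_prop), cfc_const a A hA, cfc_const_mul_id b A hA,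
    add_apply, inner_add_right, map_add, Algebra.algebraMap_eq_smul_one]
  simp only [smul_apply, one_apply_eq_self]
  rw [← Complex.coe_smul, ← Complex.coe_smul, inner_smul_right, inner_smul_right,
    inner_self_eq_norm_sq_to_K]
  simp [← Complex.ofReal_pow]

/-- Jensen's inequality for the quadratic form of `|A|^p` on the unit ball. -/
lemma ofReal_re_inner_rpow_le {A : H →L[ℂ] H} (hA : IsSelfAdjoint A) {p : ℝ} (hp : 1 ≤ p)
    {v : H} (hv : ‖v‖ ≤ 1) :
    ENNReal.ofReal (RCLike.re ⟪v, A v⟫) ^ p ≤ ENNReal.ofReal (RCLike.re ⟪v, absPow A p v⟫) := by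
  set r := RCLike.re ⟪v, A v⟫ with hr
  rcases le_or_gt r 0 with h0 | h0
  · rw [ENNReal.ofReal_of_nonpos h0, ENNReal.zero_rpow_of_pos (by linarith)]
    exact zero_le
  rw [ENNReal.ofReal_rpow_of_pos h0]
  apply ENNReal.ofReal_le_ofReal
  have hv0 : 0 < ‖v‖ := by
    rw [norm_pos_iff]
    rintro rfl
    simp [hr] at h0
  have hn : 0 < ‖v‖ ^ 2 := by positivity
  have hn1 : ‖v‖ ^ 2 ≤ 1 := by nlinarith
  set s := r / ‖v‖ ^ 2 with hs
  have hs0 : 0 < s := by positivity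
  have hle : cfc (fun t : ℝ => (s ^ p - p * s ^ (p - 1) * s) + (p * s ^ (p - 1)) * t) A
      ≤ absPow A p := by
    have hc : Continuous fun t : ℝ => |t| ^ p :=
      (Real.continuous_rpow_const (by linarith)).comp continuous_abs
    rw [absPow_eq_cfc_abs_rpow hA (by linarith)]
    refine cfc_mono (fun t _ => ?_) (by fun_prop) hc.continuousOn
    have := rpow_add_mul_sub_le_abs_rpow hp hs0 t
    linarith
  have h1 := re_inner_le_of_le hle v
  rw [re_inner_cfc_affine hA, ← hr] at h1
  have hrs : r = s * ‖v‖ ^ 2 := by rw [hs]; field_simp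
  have h2 : r ^ p ≤ s ^ p * ‖v‖ ^ 2 := by
    rw [hrs, Real.mul_rpow hs0.le hn.le]
    gcongr
    exact Real.rpow_le_self_of_le_one hn.le hn1 hp
  calc r ^ p ≤ s ^ p * ‖v‖ ^ 2 := h2
    _ = (s ^ p - p * s ^ (p - 1) * s) * ‖v‖ ^ 2 + p * s ^ (p - 1) * r := by rw [hrs]; ring
    _ ≤ _ := h1

lemma re_inner_cfc_le_of_eigenvector {A : H →L[ℂ] H} (hA : IsSelfAdjoint A) {g : ℝ → ℝ}
    (hg : Continuous g) {e : H} (he : ‖e‖ = 1) {l : ℝ} (hl : A e = (l : ℂ) • e) :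
    RCLike.re ⟪e, cfc g A e⟫ ≤ g l := by
  refine le_of_forall_pos_le_add fun ε hε => ?_
  obtain ⟨δ, hδ, hgδ⟩ := Metric.continuous_iff.1 hg l ε hε
  obtain ⟨K, hK⟩ := (ContinuousFunctionalCalculus.isCompact_spectrum (R := ℝ) A).bddAbove_image
    hg.continuousOn
  set C := |K - g l| / δ ^ 2
  have hle : cfc g A ≤ cfc (fun t : ℝ => (g l + ε + 0 * t) + C * ((t - l) * (t - l))) A := by
    refine cfc_mono (fun t ht => ?_) hg.continuousOn (by fun_prop)
    have hC : 0 ≤ C := by positivity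
    rcases lt_or_ge (dist t l) δ with h | h
    · have h1 := hgδ t h
      rw [Real.dist_eq] at h1
      have h2 := (abs_lt.1 h1).2
      nlinarith [mul_nonneg hC (mul_self_nonneg (t - l))]
    · have h1 : g t ≤ K := hK ⟨t, ht, rfl⟩
      have h2 : |K - g l| ≤ C * ((t - l) * (t - l)) := by
        rw [Real.dist_eq] at h
        have h3 : δ ^ 2 ≤ (t - l) * (t - l) := by
          rw [← abs_mul_abs_self (t - l)]
          nlinarith
        calc |K - g l| = C * δ ^ 2 := by simp only [C]; field_simp
          _ ≤ _ := by gcongr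
      linarith [le_abs_self (K - g l)]
  have h1 := re_inner_le_of_le hle e
  have h2 : cfc (fun t : ℝ => t - l) A e = 0 := by
    rw [cfc_sub _ _ _ (by fun_prop) (by fun_prop), cfc_const l A hA, cfc_id' ℝ A hA,
      Algebra.algebraMap_eq_smul_one]
    simp [hl, ← Complex.coe_smul]
  rw [cfc_add _ _ _ (by fun_prop) (by fun_prop), cfc_const_mul _ _ _ (by fun_prop),
    cfc_mul _ _ _ (by fun_prop) (by fun_prop), add_apply, inner_add_right,
    map_add, re_inner_cfc_affine hA, he] at h1
  simpa [h2] using h1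

/-- The positive part `⟨v, A v⟩⁺ ∈ [0,∞]` of the quadratic form of `A`. -/
def posForm (A : H →L[ℂ] H) (v : H) : ENNReal :=
  ENNReal.ofReal (RCLike.re ⟪v, A v⟫)

lemma posForm_rpow_le {A : H →L[ℂ] H} (hA : IsSelfAdjoint A) {p : ℝ} (hp : 1 ≤ p)
    {v : H} (hv : ‖v‖ ≤ 1) : posForm A v ^ p ≤ posForm (absPow A p) v :=
  ofReal_re_inner_rpow_le hA hp hv

lemma posForm_mul_self {M : H →L[ℂ] H} (hM : IsSelfAdjoint M) (v : H) :
    posForm (M * M) v = ‖M v‖ₑ ^ 2 := by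
  rw [posForm, re_inner_mul_self_of_isSelfAdjoint hM, ENNReal.ofReal_pow (norm_nonneg _),
    ofReal_norm]

lemma HilbertBasis.tsum_enorm_inner_sq {ι : Type*} (f : HilbertBasis ι ℂ H) (v : H) :
    ∑' i, ‖⟪f i, v⟫‖ₑ ^ 2 = ‖v‖ₑ ^ 2 := by
  have h := (f.hasSum_inner_mul_inner v v).mapL Complex.reCLM
  have h1 : ∀ i, Complex.reCLM (⟪v, f i⟫ * ⟪f i, v⟫) = ‖⟪f i, v⟫‖ ^ 2 := fun i => by
    rw [← inner_conj_symm, mul_comm, RCLike.mul_conj]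
    norm_cast
  have h2 : Complex.reCLM ⟪v, v⟫ = ‖v‖ ^ 2 := by
    rw [inner_self_eq_norm_sq_to_K]
    norm_cast
  simp only [h1, h2] at h
  have h3 := ENNReal.ofReal_tsum_of_nonneg (fun i => sq_nonneg ‖⟪f i, v⟫‖) h.summable
  rw [h.tsum_eq] at h3
  simpa [ENNReal.ofReal_pow] using h3.symm

/-- The Hilbert–Schmidt norm of an operator and of its adjoint agree. -/
lemma HilbertBasis.tsum_enorm_sq_eq_adjoint {ι κ : Type*} (e : HilbertBasis ι ℂ H)
    (f : HilbertBasis κ ℂ H) (B : H →L[ℂ] H) :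
    ∑' j, ‖B (e j)‖ₑ ^ 2 = ∑' i, ‖adjoint B (f i)‖ₑ ^ 2 := by
  simp_rw [← f.tsum_enorm_inner_sq (B _), ← e.tsum_enorm_inner_sq (adjoint B _)]
  rw [ENNReal.tsum_comm]
  refine tsum_congr fun i => tsum_congr fun j => ?_
  rw [ContinuousLinearMap.adjoint_inner_right, ← ofReal_norm, ← ofReal_norm, norm_inner_symm]

lemma HilbertBasis.enorm_sq_le_tsum {ι : Type*} (f : HilbertBasis ι ℂ H) (B : H →L[ℂ] H) (v : H) :
    ‖B v‖ₑ ^ 2 ≤ ‖v‖ₑ ^ 2 * ∑' i, ‖B (f i)‖ₑ ^ 2 := by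
  rw [f.tsum_enorm_sq_eq_adjoint f, ← f.tsum_enorm_inner_sq (B v), ← ENNReal.tsum_mul_left]
  refine ENNReal.tsum_le_tsum fun i => ?_
  rw [← ContinuousLinearMap.adjoint_inner_left, mul_comm, ← mul_pow]
  gcongr
  rw [← ofReal_norm, ← ofReal_norm, ← ofReal_norm, ← ENNReal.ofReal_mul (norm_nonneg _)]
  exact ENNReal.ofReal_le_ofReal (norm_inner_le_norm _ _)

lemma tsum_posForm_absPow_eq {ι κ : Type*} (e : HilbertBasis ι ℂ H) (f : HilbertBasis κ ℂ H)
    (A R : H →L[ℂ] H) {p : ℝ} (hp : 0 ≤ p) :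
    ∑' j, posForm (absPow A p) (R (e j)) = ∑' i, posForm (absPow A p) (R (f i)) := by
  obtain ⟨M, hM, h⟩ := exists_isSelfAdjoint_mul_self_eq_absPow A hp
  simp_rw [h, posForm_mul_self hM]
  exact (e.tsum_enorm_sq_eq_adjoint f (M ∘L R)).trans (f.tsum_enorm_sq_eq_adjoint f (M ∘L R)).symm

lemma posForm_absPow_le_tsum {ι : Type*} (f : HilbertBasis ι ℂ H) (A R : H →L[ℂ] H) {p : ℝ}
    (hp : 0 ≤ p) {v : H} (hv : ‖v‖ ≤ 1) :
    posForm (absPow A p) (R v) ≤ ∑' i, posForm (absPow A p) (R (f i)) := by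
  obtain ⟨M, hM, h⟩ := exists_isSelfAdjoint_mul_self_eq_absPow A hp
  simp_rw [h, posForm_mul_self hM]
  refine (f.enorm_sq_le_tsum (M ∘L R) v).trans (mul_le_of_le_one_left' ?_)
  refine pow_le_one' ?_ 2
  rw [← ofReal_norm]
  exact ENNReal.ofReal_le_one.2 hv

/-- The span of the first `N` vectors of a Hilbert basis. -/
def headSpan (f : HilbertBasis ℕ ℂ H) (N : ℕ) : Submodule ℂ H :=
  Submodule.span ℂ (f '' (Finset.range N : Set ℕ))

instance (f : HilbertBasis ℕ ℂ H) (N : ℕ) : FiniteDimensional ℂ (headSpan f N) :=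
  FiniteDimensional.span_of_finite ℂ ((Finset.finite_toSet _).image _)

lemma mem_headSpan (f : HilbertBasis ℕ ℂ H) {N i : ℕ} (hi : i < N) : f i ∈ headSpan f N :=
  Submodule.subset_span ⟨i, by simpa using hi, rfl⟩

lemma mem_headSpan_orthogonal (f : HilbertBasis ℕ ℂ H) {N i : ℕ} (hi : N ≤ i) :
    f i ∈ (headSpan f N)ᗮ := by
  rw [headSpan, Submodule.mem_orthogonal]
  intro u hu
  induction hu using Submodule.span_induction with
  | mem x hx =>
    obtain ⟨j, hj, rfl⟩ := hx
    have hj' : j < N := by simpa using hj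
    exact f.orthonormal.2 (by omega)
  | zero => simp
  | add x y _ _ hx hy => rw [inner_add_left, hx, hy, add_zero]
  | smul a x _ hx => rw [inner_smul_left, hx, mul_zero]

lemma tsum_posForm_head (f : HilbertBasis ℕ ℂ H) (N : ℕ) (A : H →L[ℂ] H) :
    ∑' i, posForm A ((headSpan f N).starProjection (f i))
      = ∑ i ∈ Finset.range N, posForm A (f i) := by
  rw [tsum_eq_sum (s := Finset.range N)]
  · refine Finset.sum_congr rfl fun i hi => ?_
    rw [Submodule.starProjection_eq_self_iff.2 (mem_headSpan f (Finset.mem_range.1 hi))]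
  · intro i hi
    rw [(Submodule.starProjection_apply_eq_zero_iff _).2
      (mem_headSpan_orthogonal f (by simpa using hi))]
    simp [posForm]

lemma tsum_posForm_tail (f : HilbertBasis ℕ ℂ H) (N : ℕ) (A : H →L[ℂ] H) :
    ∑' i, posForm A ((headSpan f N)ᗮ.starProjection (f i)) = ∑' i, posForm A (f (i + N)) := by
  rw [← ENNReal.summable.sum_add_tsum_nat_add' (k := N), Finset.sum_eq_zero, zero_add]
  · refine tsum_congr fun i => ?_
    rw [Submodule.starProjection_eq_self_iff.2 (mem_headSpan_orthogonal f (Nat.le_add_left N i))]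
  · intro i hi
    rw [(Submodule.starProjection_apply_eq_zero_iff _).2
      (Submodule.le_orthogonal_orthogonal _ (mem_headSpan f (Finset.mem_range.1 hi)))]
    simp [posForm]

lemma norm_starProjection_apply_le_one (K : Submodule ℂ H) [K.HasOrthogonalProjection] {v : H}
    (hv : ‖v‖ ≤ 1) : ‖K.starProjection v‖ ≤ 1 := by
  refine (K.starProjection.le_opNorm v).trans ?_
  exact mul_le_one₀ K.starProjection_norm_le (norm_nonneg _) hv

lemma posForm_mono {A B : H →L[ℂ] H} (h : A ≤ B) (v : H) : posForm A v ≤ posForm B v :=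
  ENNReal.ofReal_le_ofReal (re_inner_le_of_le h v)

lemma exists_isSelfAdjoint_mul_self_eq {S : H →L[ℂ] H} (hS : 0 ≤ S) :
    ∃ M : H →L[ℂ] H, IsSelfAdjoint M ∧ M * M = S :=
  ⟨CFC.sqrt S, (CFC.sqrt_nonneg S).isSelfAdjoint, CFC.sqrt_mul_sqrt_self S hS⟩

/-- An operator dominated by a Schatten class operator is compact. -/
lemma isCompactOperator_of_le (f : HilbertBasis ℕ ℂ H) {p : ℝ} (hp : 1 ≤ p) {S T : H →L[ℂ] H}
    (hS : 0 ≤ S) (hST : S ≤ T) (hT : trAbsPow f T p ≠ ⊤) : IsCompactOperator S := by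
  obtain ⟨M, hM, rfl⟩ := exists_isSelfAdjoint_mul_self_eq hS
  have hTsa : IsSelfAdjoint T := (hS.trans hST).isSelfAdjoint
  have hp0 : 0 < p := by linarith
  have htail : Tendsto (fun N => ∑' i, posForm (absPow T p) (f (i + N))) atTop (𝓝 0) :=
    ENNReal.tendsto_sum_nat_add _ hT
  have hlim : Tendsto (fun N => M ∘L (headSpan f N).starProjection) atTop (𝓝 M) := by
    rw [Metric.tendsto_atTop]
    intro ε hε
    have hε' : 0 < (ENNReal.ofReal (ε / 2) ^ 2) ^ p := by positivity
    obtain ⟨N₀, hN₀⟩ := eventually_atTop.1 (htail.eventually_lt_const hε')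
    refine ⟨N₀, fun N hN => ?_⟩
    rw [dist_eq_norm, norm_sub_rev]
    refine lt_of_le_of_lt ?_ (half_lt_self hε)
    refine ContinuousLinearMap.opNorm_le_of_unit_norm (by positivity) fun v hv => ?_
    set w := (headSpan f N)ᗮ.starProjection v with hw
    have h1 : (M - M ∘L (headSpan f N).starProjection) v = M w := by
      simp [hw, Submodule.starProjection_orthogonal]
    have h2 : (‖M w‖ₑ ^ 2) ^ p ≤ (ENNReal.ofReal (ε / 2) ^ 2) ^ p := calc
      (‖M w‖ₑ ^ 2) ^ p = posForm (M * M) w ^ p := by rw [posForm_mul_self hM]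
      _ ≤ posForm T w ^ p := by gcongr; exact posForm_mono hST w
      _ ≤ posForm (absPow T p) w :=
        posForm_rpow_le hTsa hp (norm_starProjection_apply_le_one _ hv.le)
      _ ≤ ∑' i, posForm (absPow T p) ((headSpan f N)ᗮ.starProjection (f i)) :=
        posForm_absPow_le_tsum f T _ hp0.le hv.le
      _ ≤ _ := by rw [tsum_posForm_tail]; exact (hN₀ N hN).le
    rw [h1]
    rw [ENNReal.rpow_le_rpow_iff hp0, ENNReal.pow_le_pow_left_iff two_ne_zero, ← ofReal_norm,
      ENNReal.ofReal_le_ofReal_iff (by positivity)] at h2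
    exact h2
  have hMc : IsCompactOperator M := by
    refine isCompactOperator_of_tendsto hlim (Eventually.of_forall fun N => ?_)
    refine IsCompactOperator.clm_comp ?_ M
    have : ProperSpace (headSpan f N) := FiniteDimensional.proper ℂ _
    exact (isCompactOperator_of_locallyCompactSpace_dom
      ((headSpan f N).orthogonalProjectionOnto)).clm_comp (headSpan f N).subtypeL
  exact hMc.clm_comp M

/-- An orthogonal family of closed subspaces with dense span admits an adapted Hilbert basis. -/
lemma OrthogonalFamily.exists_hilbertBasis {H : Type u} [NormedAddCommGroup H] [InnerProductSpace ℂ H]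
    [CompleteSpace H] {ι : Type} {E : ι → Submodule ℂ H}
    (hE : OrthogonalFamily ℂ (fun i => E i) fun i => (E i).subtypeₗᵢ)
    (hc : ∀ i, CompleteSpace (E i)) (hbot : (⨆ i, E i)ᗮ = ⊥) :
    ∃ (κ : Type u) (e : HilbertBasis κ ℂ H), ∀ j, ∃ i, e j ∈ E i := by
  choose w b _ using fun i => _root_.exists_hilbertBasis ℂ (E i)
  have hon := hE.orthonormal_sigma_orthonormal (fun i => (b i).orthonormal)
  have hbot' : (Submodule.span ℂ (Set.range fun a : Σ i, w i =>
      (E a.1).subtypeₗᵢ (b a.1 a.2)))ᗮ = ⊥ := by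
    rw [eq_bot_iff, ← hbot]
    intro v hv
    rw [Submodule.mem_orthogonal'] at hv
    rw [← Submodule.iInf_orthogonal, Submodule.mem_iInf]
    intro i
    rw [Submodule.mem_orthogonal']
    intro u hu
    have h := ((b i).hasSum_repr ⟨u, hu⟩).mapL (innerSL ℂ v ∘L (E i).subtypeL)
    have h0 : ∀ k, (innerSL ℂ v ∘L (E i).subtypeL) ((b i).repr ⟨u, hu⟩ k • b i k) = 0 := by
      intro k
      have := hv (b i k) (Submodule.subset_span ⟨⟨i, k⟩, rfl⟩)
      simp [this]
    simp only [h0] at h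
    exact h.unique hasSum_zero
  refine ⟨Σ i, w i, HilbertBasis.mkOfOrthogonalEqBot hon hbot', fun a => ⟨a.1, ?_⟩⟩
  rw [HilbertBasis.coe_mkOfOrthogonalEqBot]
  exact (b a.1 a.2).2

/-- A compact self-adjoint operator has a Hilbert basis of eigenvectors. -/
lemma exists_hilbertBasis_eigenvectors {H : Type u} [NormedAddCommGroup H] [InnerProductSpace ℂ H]
    [CompleteSpace H] {A : H →L[ℂ] H} (hA : IsSelfAdjoint A)
    (hc : IsCompactOperator A) :
    ∃ (ι : Type u) (e : HilbertBasis ι ℂ H), ∀ j, ∃ l : ℝ, A (e j) = (l : ℂ) • e j := by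
  have hsym : (A : H →ₗ[ℂ] H).IsSymmetric := hA.isSymmetric
  have hcomplete : ∀ μ : ℂ, CompleteSpace (Module.End.eigenspace (A : H →ₗ[ℂ] H) μ) := by
    intro μ
    have h : IsClosed {v | A v = μ • v} := isClosed_eq (by fun_prop) (by fun_prop)
    have h' : (Module.End.eigenspace (A : H →ₗ[ℂ] H) μ : Set H) = {v | A v = μ • v} := by
      ext v
      simp
    rw [← h'] at h
    exact h.completeSpace_coe
  obtain ⟨ι, e, he⟩ := hsym.orthogonalFamily_eigenspaces.exists_hilbertBasis hcomplete
    (ContinuousLinearMap.orthogonalComplement_iSup_eigenspaces_eq_bot hc hsym)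
  refine ⟨ι, e, fun j => ?_⟩
  obtain ⟨μ, hμ⟩ := he j
  have hne : e j ≠ 0 := e.orthonormal.ne_zero j
  have hconj := hsym.conj_eigenvalue_eq_self
    (Module.End.hasEigenvalue_of_hasEigenvector ⟨hμ, hne⟩)
  refine ⟨μ.re, ?_⟩
  rw [Complex.conj_eq_iff_re.1 hconj]
  exact Module.End.mem_eigenspace_iff.1 hμ

/-- Minkowski's inequality for `ℝ≥0∞`-valued families. -/
lemma ENNReal.tsum_rpow_add_le {ι : Type*} {p : ℝ} (hp : 1 ≤ p) (a b : ι → ENNReal) :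
    (∑' i, (a i + b i) ^ p) ^ (1 / p) ≤ (∑' i, a i ^ p) ^ (1 / p) + (∑' i, b i ^ p) ^ (1 / p) := by
  let : MeasurableSpace ι := ⊤
  have h := ENNReal.lintegral_Lp_add_le (μ := MeasureTheory.Measure.count) (f := a) (g := b)
    measurable_from_top.aemeasurable measurable_from_top.aemeasurable hp
  simpa only [MeasureTheory.lintegral_count, Pi.add_apply] using h

lemma trAbsPow_eq_tsum_posForm {ι : Type*} (f : HilbertBasis ℕ ℂ H) (e : HilbertBasis ι ℂ H)
    (A : H →L[ℂ] H) {p : ℝ} (hp : 0 ≤ p) :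
    trAbsPow f A p = ∑' j, posForm (absPow A p) (e j) :=
  tsum_posForm_absPow_eq f e A (ContinuousLinearMap.id ℂ H) hp

lemma tsum_posForm_rpow_le_trAbsPow {ι : Type*} (f : HilbertBasis ℕ ℂ H) (e : HilbertBasis ι ℂ H)
    {A : H →L[ℂ] H} (hA : IsSelfAdjoint A) {p : ℝ} (hp : 1 ≤ p) :
    ∑' j, posForm A (e j) ^ p ≤ trAbsPow f A p := by
  rw [trAbsPow_eq_tsum_posForm f e A (by linarith)]
  exact ENNReal.tsum_le_tsum fun j => posForm_rpow_le hA hp (e.orthonormal.1 j).le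

/-- Jensen's inequality for a contraction applied to a Hilbert basis. -/
lemma tsum_posForm_rpow_comp_le {ι : Type*} (f : HilbertBasis ℕ ℂ H) (e : HilbertBasis ι ℂ H)
    {A : H →L[ℂ] H} (hA : IsSelfAdjoint A) {p : ℝ} (hp : 1 ≤ p) (K : Submodule ℂ H)
    [K.HasOrthogonalProjection] :
    ∑' j, posForm A (K.starProjection (e j)) ^ p
      ≤ ∑' i, posForm (absPow A p) (K.starProjection (f i)) := by
  rw [← tsum_posForm_absPow_eq e f A _ (by linarith)]
  exact ENNReal.tsum_le_tsum fun j =>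
    posForm_rpow_le hA hp (norm_starProjection_apply_le_one K (e.orthonormal.1 j).le)

lemma trAbsPow_le_tsum_of_eigenvectors {ι : Type*} (f : HilbertBasis ℕ ℂ H)
    (e : HilbertBasis ι ℂ H) {A : H →L[ℂ] H} (hA : IsSelfAdjoint A) {p : ℝ} (hp : 1 ≤ p)
    (he : ∀ j, ∃ l : ℝ, A (e j) = (l : ℂ) • e j) :
    trAbsPow f A p ≤ ∑' j, ENNReal.ofReal |RCLike.re ⟪e j, A (e j)⟫| ^ p := by
  rw [trAbsPow_eq_tsum_posForm f e A (by linarith)]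
  refine ENNReal.tsum_le_tsum fun j => ?_
  obtain ⟨l, hl⟩ := he j
  have hc : Continuous fun t : ℝ => |t| ^ p :=
    (Real.continuous_rpow_const (by linarith)).comp continuous_abs
  have hn : ‖e j‖ = 1 := e.orthonormal.1 j
  have hle := re_inner_cfc_le_of_eigenvector hA hc hn hl
  have hre : RCLike.re ⟪e j, A (e j)⟫ = l := by
    rw [hl, inner_smul_right, inner_self_eq_norm_sq_to_K, hn]
    simp
  rw [hre, ENNReal.ofReal_rpow_of_nonneg (abs_nonneg l) (by linarith), posForm,
    absPow_eq_cfc_abs_rpow hA (by linarith)]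
  exact ENNReal.ofReal_le_ofReal hle

lemma trAbsPow_le_tsum_posForm {ι : Type*} (f : HilbertBasis ℕ ℂ H)
    (e : HilbertBasis ι ℂ H) {S : H →L[ℂ] H} (hS : 0 ≤ S) {p : ℝ} (hp : 1 ≤ p)
    (he : ∀ j, ∃ l : ℝ, S (e j) = (l : ℂ) • e j) :
    trAbsPow f S p ≤ ∑' j, posForm S (e j) ^ p := by
  refine (trAbsPow_le_tsum_of_eigenvectors f e hS.isSelfAdjoint hp he).trans_eq ?_
  refine tsum_congr fun j => ?_
  rw [abs_of_nonneg, posForm]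
  exact ((ContinuousLinearMap.nonneg_iff_isPositive S).1 hS).re_inner_nonneg_right _

lemma trAbsPow_mono (f : HilbertBasis ℕ ℂ H) {p : ℝ} (hp : 1 ≤ p) {S T : H →L[ℂ] H}
    (hS : 0 ≤ S) (hST : S ≤ T) : trAbsPow f S p ≤ trAbsPow f T p := by
  by_cases hT : trAbsPow f T p = ⊤
  · simp [hT]
  obtain ⟨ι, e, he⟩ := exists_hilbertBasis_eigenvectors hS.isSelfAdjoint
    (isCompactOperator_of_le f hp hS hST hT)
  refine (trAbsPow_le_tsum_posForm f e hS hp he).trans ?_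
  refine le_trans ?_ (tsum_posForm_rpow_le_trAbsPow f e (hS.trans hST).isSelfAdjoint hp)
  exact ENNReal.tsum_le_tsum fun j => by gcongr; exact posForm_mono hST _

lemma posForm_add_le (A B : H →L[ℂ] H) (v : H) : posForm (A + B) v ≤ posForm A v + posForm B v := by
  simp only [posForm, add_apply, inner_add_right, map_add]
  exact ENNReal.ofReal_add_le

lemma trAbsPow_sub_ne_top (f : HilbertBasis ℕ ℂ H) {p : ℝ} (hp : 1 ≤ p) {A B : H →L[ℂ] H}
    (hA : 0 ≤ A) (hB : 0 ≤ B) (hAp : trAbsPow f A p ≠ ⊤) (hBp : trAbsPow f B p ≠ ⊤) :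
    trAbsPow f (A - B) p ≠ ⊤ := by
  have hsa : IsSelfAdjoint (A - B) := hA.isSelfAdjoint.sub hB.isSelfAdjoint
  have hp0 : 0 < p := by linarith
  obtain ⟨ι, e, he⟩ := exists_hilbertBasis_eigenvectors hsa
    ((isCompactOperator_of_le f hp hA le_rfl hAp).sub (isCompactOperator_of_le f hp hB le_rfl hBp))
  refine ne_top_of_le_ne_top ?_ (trAbsPow_le_tsum_of_eigenvectors f e hsa hp he)
  have h1 : ∑' j, ENNReal.ofReal |RCLike.re ⟪e j, (A - B) (e j)⟫| ^ p
      ≤ ∑' j, (posForm A (e j) + posForm B (e j)) ^ p := by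
    refine ENNReal.tsum_le_tsum fun j => ?_
    have hA0 := ((ContinuousLinearMap.nonneg_iff_isPositive A).1 hA).re_inner_nonneg_right (e j)
    have hB0 := ((ContinuousLinearMap.nonneg_iff_isPositive B).1 hB).re_inner_nonneg_right (e j)
    gcongr
    rw [posForm, posForm, ← ENNReal.ofReal_add hA0 hB0]
    refine ENNReal.ofReal_le_ofReal ?_
    rw [sub_apply, inner_sub_right, map_sub, abs_le]
    constructor <;> linarith
  refine ne_top_of_le_ne_top ?_ h1
  have h2 := ENNReal.tsum_rpow_add_le hp (fun j => posForm A (e j)) (fun j => posForm B (e j))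
  have h3 : ∀ {T : H →L[ℂ] H}, 0 ≤ T → trAbsPow f T p ≠ ⊤ →
      (∑' j, posForm T (e j) ^ p) ^ (1 / p) ≠ ⊤ := fun hT hTp =>
    ENNReal.rpow_ne_top_of_nonneg (by positivity)
      (ne_top_of_le_ne_top hTp (tsum_posForm_rpow_le_trAbsPow f e hT.isSelfAdjoint hp))
  intro htop
  rw [htop, ENNReal.top_rpow_of_pos (by positivity)] at h2
  exact ENNReal.add_ne_top.2 ⟨h3 hA hAp, h3 hB hBp⟩ (top_le_iff.1 h2)

/-- If `0 ≤ S ≤ T`, then `tr S^p` is controlled by the first `N` diagonal entries of `S^p`, the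
remaining diagonal entries of `|T₀|^p`, and `tr |T - T₀|^p`. -/
lemma trAbsPow_rpow_le_head_add_tail (f : HilbertBasis ℕ ℂ H) {p : ℝ} (hp : 1 ≤ p)
    {S T T₀ : H →L[ℂ] H} (hS : 0 ≤ S) (hST : S ≤ T) (hT : trAbsPow f T p ≠ ⊤)
    (hT₀ : IsSelfAdjoint T₀) (N : ℕ) :
    trAbsPow f S p ^ (1 / (2 * p)) ≤
      (∑ i ∈ Finset.range N, posForm (absPow S p) (f i)) ^ (1 / (2 * p)) +
      ((∑' i, posForm (absPow T₀ p) (f (i + N))) ^ (1 / p) +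
        trAbsPow f (T - T₀) p ^ (1 / p)) ^ (1 / 2 : ℝ) := by
  have hp0 : 0 < p := by linarith
  have hSsa := hS.isSelfAdjoint
  have hD : IsSelfAdjoint (T - T₀) := (hS.trans hST).isSelfAdjoint.sub hT₀
  obtain ⟨ι, e, he⟩ := exists_hilbertBasis_eigenvectors hSsa (isCompactOperator_of_le f hp hS hST hT)
  obtain ⟨M, hM, hMS⟩ := exists_isSelfAdjoint_mul_self_eq hS
  set P := (headSpan f N).starProjection with hP
  set Q := (headSpan f N)ᗮ.starProjection with hQ
  have hform : ∀ v, posForm S v ^ p = ‖M v‖ₑ ^ (2 * p) := fun v => by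
    rw [← hMS, posForm_mul_self hM, ENNReal.rpow_mul]
    norm_cast
  have h1 : trAbsPow f S p ≤ ∑' j, (‖M (P (e j))‖ₑ + ‖M (Q (e j))‖ₑ) ^ (2 * p) := by
    refine (trAbsPow_le_tsum_posForm f e hS hp he).trans (ENNReal.tsum_le_tsum fun j => ?_)
    rw [hform]
    gcongr
    have hsum : e j = P (e j) + Q (e j) :=
      ((headSpan f N).starProjection_add_starProjection_orthogonal (e j)).symm
    conv_lhs => rw [hsum, map_add]
    exact enorm_add_le _ _
  have hhead : ∑' j, ‖M (P (e j))‖ₑ ^ (2 * p)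
      ≤ ∑ i ∈ Finset.range N, posForm (absPow S p) (f i) := by
    simp_rw [← hform]
    exact (tsum_posForm_rpow_comp_le f e hSsa hp _).trans_eq (tsum_posForm_head f N _)
  have htail : (∑' j, ‖M (Q (e j))‖ₑ ^ (2 * p)) ^ (1 / p)
      ≤ (∑' i, posForm (absPow T₀ p) (f (i + N))) ^ (1 / p) +
        trAbsPow f (T - T₀) p ^ (1 / p) := by
    simp_rw [← hform]
    calc (∑' j, posForm S (Q (e j)) ^ p) ^ (1 / p)
        ≤ (∑' j, (posForm T₀ (Q (e j)) + posForm (T - T₀) (Q (e j))) ^ p) ^ (1 / p) := by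
          gcongr with j
          refine (posForm_mono hST _).trans ?_
          conv_lhs => rw [← add_sub_cancel T₀ T]
          exact posForm_add_le _ _ _
      _ ≤ _ := ENNReal.tsum_rpow_add_le hp _ _
      _ ≤ _ := by
          gcongr
          · exact (tsum_posForm_rpow_comp_le f e hT₀ hp _).trans_eq (tsum_posForm_tail f N _)
          · refine (tsum_posForm_rpow_comp_le f e hD hp _).trans ?_
            rw [tsum_posForm_tail]
            exact ENNReal.tsum_comp_le_tsum_of_injective (add_left_injective N)
              (fun i => posForm (absPow (T - T₀) p) (f i))
  calc trAbsPow f S p ^ (1 / (2 * p))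
      ≤ (∑' j, (‖M (P (e j))‖ₑ + ‖M (Q (e j))‖ₑ) ^ (2 * p)) ^ (1 / (2 * p)) := by gcongr
    _ ≤ (∑' j, ‖M (P (e j))‖ₑ ^ (2 * p)) ^ (1 / (2 * p)) +
        (∑' j, ‖M (Q (e j))‖ₑ ^ (2 * p)) ^ (1 / (2 * p)) :=
      ENNReal.tsum_rpow_add_le (by linarith) _ _
    _ ≤ _ := by
      gcongr ?_ + ?_
      · gcongr
      · have hexp : 1 / (2 * p) = (1 / p) * (1 / 2) := by field_simp
        rw [hexp, ENNReal.rpow_mul]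
        gcongr

lemma continuous_posForm_absPow {X : Type*} [TopologicalSpace X] {S : X → H →L[ℂ] H}
    (hS : Continuous S) {C : ℝ} (hC : ∀ x, ‖S x‖ ≤ C) {p : ℝ} (hp : 0 ≤ p) (v : H) :
    Continuous fun x => posForm (absPow (S x) p) v := by
  have hc : Continuous fun t : ℝ => t ^ (p / 2) := Real.continuous_rpow_const (by positivity)
  have hcont : Continuous fun x => adjoint (S x) ∘L S x :=
    (continuous_star.comp hS).clm_comp hS
  have habs : Continuous fun x => absPow (S x) p := by
    refine hcont.cfc' (isCompact_closedBall (0 : ℝ) (C ^ 2)) _ (fun x => ?_) hc.continuousOn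
      (fun x => IsSelfAdjoint.star_mul_self (S x))
    refine (spectrum.subset_closedBall_norm_mul _).trans (Metric.closedBall_subset_closedBall ?_)
    have h1 : ‖adjoint (S x) ∘L S x‖ ≤ C ^ 2 := by
      rw [ContinuousLinearMap.norm_adjoint_comp_self, ← sq]
      gcongr
      exact hC x
    calc ‖adjoint (S x) ∘L S x‖ * ‖(1 : H →L[ℂ] H)‖ ≤ ‖adjoint (S x) ∘L S x‖ * 1 := by
          gcongr
          exact ContinuousLinearMap.norm_id_le
      _ ≤ C ^ 2 := by rwa [mul_one]
  exact ENNReal.continuous_ofReal.comp (RCLike.continuous_re.comp (by fun_prop))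

lemma continuous_trAbsPow (f : HilbertBasis ℕ ℂ H) {p : ℝ} (hp : 1 ≤ p) {X : Type*}
    [TopologicalSpace X] {S T : X → H →L[ℂ] H} {C : ℝ} (hSb : ∀ x, ‖S x‖ ≤ C)
    (hS : ∀ x, 0 ≤ S x) (hST : ∀ x, S x ≤ T x) (hT : ∀ x, trAbsPow f (T x) p ≠ ⊤)
    (hTcont : ∀ x, Tendsto (fun y => sNorm f p (T y - T x)) (𝓝 x) (𝓝 0)) (hScont : Continuous S) :
    Continuous fun x => trAbsPow f (S x) p := by
  have hp0 : 0 < p := by linarith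
  have hT0 : ∀ x, 0 ≤ T x := fun x => (hS x).trans (hST x)
  have hhead : ∀ N, Continuous fun x => ∑ i ∈ Finset.range N, posForm (absPow (S x) p) (f i) :=
    fun N => continuous_finsetSum _ fun i _ => continuous_posForm_absPow hScont hSb hp0.le (f i)
  have hhead_le : ∀ N x, ∑ i ∈ Finset.range N, posForm (absPow (S x) p) (f i)
      ≤ trAbsPow f (S x) p := fun N x => ENNReal.sum_le_tsum _
  refine continuous_iff_continuousAt.2 fun x => tendsto_order.2 ⟨fun a ha => ?_, fun b hb => ?_⟩
  · have hlim : Tendsto (fun N => ∑ i ∈ Finset.range N, posForm (absPow (S x) p) (f i)) atTop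
        (𝓝 (trAbsPow f (S x) p)) := ENNReal.tendsto_nat_tsum _
    obtain ⟨N, hN⟩ := (hlim.eventually_const_lt ha).exists
    filter_upwards [(hhead N).continuousAt.eventually_const_lt hN] with y hy
    exact hy.trans_le (hhead_le N y)
  have hexp : 0 < 1 / (2 * p) := by positivity
  have hdist : Tendsto (fun y => trAbsPow f (T y - T x) p ^ (1 / p)) (𝓝 x) (𝓝 0) := by
    have h := ENNReal.tendsto_ofReal (hTcont x)
    rw [ENNReal.ofReal_zero] at h
    refine h.congr fun y => ?_
    have hne := trAbsPow_sub_ne_top f hp (hT0 y) (hT0 x) (hT y) (hT x)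
    rw [sNorm, ← ENNReal.ofReal_rpow_of_nonneg ENNReal.toReal_nonneg (by positivity),
      ENNReal.ofReal_toReal hne]
  have hb' : trAbsPow f (S x) p ^ (1 / (2 * p)) < b ^ (1 / (2 * p)) :=
    (ENNReal.rpow_lt_rpow_iff hexp).2 hb
  have hrem : Tendsto (fun N => trAbsPow f (S x) p ^ (1 / (2 * p)) +
      ((∑' i, posForm (absPow (T x) p) (f (i + N))) ^ (1 / p) + 0) ^ (1 / 2 : ℝ)) atTop
      (𝓝 (trAbsPow f (S x) p ^ (1 / (2 * p)))) := by
    have h1 : Tendsto (fun N => ∑' i, posForm (absPow (T x) p) (f (i + N))) atTop (𝓝 0) :=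
      ENNReal.tendsto_sum_nat_add _ (hT x)
    have h2 := ((h1.ennrpow_const (1 / p)).add_const 0).ennrpow_const (1 / 2 : ℝ)
    have h3 := h2.const_add (trAbsPow f (S x) p ^ (1 / (2 * p)))
    rwa [ENNReal.zero_rpow_of_pos (by positivity), add_zero,
      ENNReal.zero_rpow_of_pos (by positivity), add_zero] at h3
  obtain ⟨N, hN⟩ := (hrem.eventually_lt_const hb').exists
  have hbound : Tendsto (fun y =>
      (∑ i ∈ Finset.range N, posForm (absPow (S y) p) (f i)) ^ (1 / (2 * p)) +
      ((∑' i, posForm (absPow (T x) p) (f (i + N))) ^ (1 / p) +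
        trAbsPow f (T y - T x) p ^ (1 / p)) ^ (1 / 2 : ℝ)) (𝓝 x)
      (𝓝 ((∑ i ∈ Finset.range N, posForm (absPow (S x) p) (f i)) ^ (1 / (2 * p)) +
      ((∑' i, posForm (absPow (T x) p) (f (i + N))) ^ (1 / p) + 0) ^ (1 / 2 : ℝ))) :=
    (((hhead N).tendsto x).ennrpow_const _).add ((hdist.const_add _).ennrpow_const _)
  have hlt : (∑ i ∈ Finset.range N, posForm (absPow (S x) p) (f i)) ^ (1 / (2 * p)) +
      ((∑' i, posForm (absPow (T x) p) (f (i + N))) ^ (1 / p) + 0) ^ (1 / 2 : ℝ)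
      < b ^ (1 / (2 * p)) := by
    refine lt_of_le_of_lt ?_ hN
    gcongr
    exact hhead_le N x
  filter_upwards [hbound.eventually_lt_const hlt] with y hy
  rw [← ENNReal.rpow_lt_rpow_iff hexp]
  exact (trAbsPow_rpow_le_head_add_tail f hp (hS y) (hST y) (hT y) (hT0 x).isSelfAdjoint N).trans_lt
    hy

/-- if `0 ≤ S(x) ≤ T(x)` pointwise, `T ∈ C₀(X, S_p(H))`, and `S` is
operator-norm continuous, then each `S(x) ∈ S_p(H)`, the function `x ↦ tr S(x)^p`
lies in `C₀(X)`, and `tr S(x)^p ≤ tr T(x)^p` for every `x`. -/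
theorem schatten_order_ideal_of_norm_continuous {X : Type*} [TopologicalSpace X]
    [LocallyCompactSpace X] [T2Space X]
    (f : HilbertBasis ℕ ℂ H) (p : ℝ) (hp : 1 ≤ p)
    (S T : X → H →L[ℂ] H)
    (CS : ℝ) (hSb : ∀ x, ‖S x‖ ≤ CS) (CT : ℝ) (hTb : ∀ x, ‖T x‖ ≤ CT)
    (hpos : ∀ x, (S x).IsPositive) (hle : ∀ x, (T x - S x).IsPositive)
    (hT : IsC0Schatten f p T)
    (hScont : Continuous S) :
    (∀ x, trAbsPow f (S x) p ≠ ⊤) ∧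
    Continuous (fun x => (trAbsPow f (S x) p).toReal) ∧
    Tendsto (fun x => (trAbsPow f (S x) p).toReal) (cocompact X) (nhds 0) ∧
    ∀ x, trAbsPow f (S x) p ≤ trAbsPow f (T x) p := by
  have hS0 : ∀ x, 0 ≤ S x := fun x => (ContinuousLinearMap.nonneg_iff_isPositive _).2 (hpos x)
  have hST : ∀ x, S x ≤ T x := fun x => (ContinuousLinearMap.le_def _ _).2 (hle x)
  obtain ⟨hTfin, hTcont, hTzero⟩ := hT
  have hp0 : 0 < p := by linarith
  have hmono : ∀ x, trAbsPow f (S x) p ≤ trAbsPow f (T x) p :=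
    fun x => trAbsPow_mono f hp (hS0 x) (hST x)
  have hSfin : ∀ x, trAbsPow f (S x) p ≠ ⊤ := fun x => ne_top_of_le_ne_top (hTfin x) (hmono x)
  refine ⟨hSfin, ?_, ?_, hmono⟩
  · have hcont := continuous_trAbsPow f hp hSb hS0 hST hTfin hTcont hScont
    exact continuous_iff_continuousAt.2 fun x =>
      (ENNReal.tendsto_toReal (hSfin x)).comp hcont.continuousAt
  · have h : Tendsto (fun x => sNorm f p (T x) ^ p) (cocompact X) (𝓝 0) := by
      simpa [Real.zero_rpow hp0.ne'] using hTzero.rpow_const (Or.inr hp0.le)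
    refine squeeze_zero (fun x => ENNReal.toReal_nonneg) (fun x => ?_) h
    rw [sNorm, ← Real.rpow_mul ENNReal.toReal_nonneg, one_div_mul_cancel hp0.ne', Real.rpow_one]
    exact ENNReal.toReal_mono (hTfin x) (hmono x)

end
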